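/- arXiv:2201.03069 — 2 statements merged into one kernel-verified Lean document; each statement's English description precedes it below -/
import Mathlib

section
/- (Schanuel's lemma for injective resolutions, odd case.) Let 𝒜 be an abelian category and let E be an object of 𝒜. Suppose given two injective resolutions of E presented as chains of short exact sequences: objects I^k, G^k (k ≥ 0) with each I^k injective, G^0 ≅ E, and short exact sequences 0 → G^k → I^k → G^{k+1} → 0 for every k ≥ 0; and likewise objects J^k, H^k with each J^k injective, H^0 ≅ E, and short exact sequences 0 → H^k → J^k → H^{k+1} → 0 for every k ≥ 0. Then for every n ≥ 1 there is an isomorphism I^0 ⊞ J^1 ⊞ I^2 ⊞ ⋯ ⊞ J^{2n-1} ⊞ I^{2n} ⊞ H^{2n+1} ≅ J^0 ⊞ I^1 ⊞ J^2 ⊞ ⋯ ⊞ I^{2n-1} ⊞ J^{2n} ⊞ G^{2n+1} (the left-hand biproduct runs over I^k for even k ≤ 2n and J^k for odd k ≤ 2n, followed by H^{2n+1}; the right-hand biproduct swaps the roles of I and J and ends with G^{2n+1}). -/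
open CategoryTheory CategoryTheory.Limits

attribute [local instance] CategoryTheory.Abelian.hasFiniteBiproducts

universe v u

namespace CategoryTheory

variable {𝒜 : Type u} [Category.{v} 𝒜] [Abelian 𝒜]

namespace ShortComplex.ShortExact

/-- The pushout of a short exact sequence along a morphism out of its first object. -/
lemma of_isPushout {X I C J P : 𝒜} {f : X ⟶ I} {g : I ⟶ C} {w : f ≫ g = 0}
    (h : (ShortComplex.mk f g w).ShortExact) {u : X ⟶ J} {inl : I ⟶ P} {inr : J ⟶ P}
    (sq : IsPushout f u inl inr) :
    ∃ (p : P ⟶ C) (w' : inr ≫ p = 0), (ShortComplex.mk inr p w').ShortExact := by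
  have : Mono f := h.mono_f
  have : Epi g := h.epi_g
  have hinl : inl ≫ sq.desc g 0 (by simp [w]) = g := sq.inl_desc _ _ _
  have hinr : inr ≫ sq.desc g 0 (by simp [w]) = 0 := sq.inr_desc _ _ _
  have hp : Epi (sq.desc g 0 (by simp [w])) := epi_of_epi_fac hinl
  refine ⟨_, hinr, .mk' (ShortComplex.exact_of_g_is_cokernel _ ?_)
    (MorphismProperty.of_isPushout (P := .monomorphisms 𝒜) sq.flip (.infer_property f)) hp⟩
  refine CokernelCofork.IsColimit.ofπ' _ hinr fun {Z} k hk ↦ ?_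
  have hk' : f ≫ inl ≫ k = 0 := by rw [sq.w_assoc, hk, comp_zero]
  exact ⟨h.exact.desc (inl ≫ k) hk', sq.hom_ext
    (by rw [reassoc_of% hinl]; exact h.exact.g_desc _ _) (by rw [reassoc_of% hinr, hk, zero_comp])⟩

/-- Adding a direct summand to the first two objects of a short exact sequence. -/
lemma biprod_map_id {X I C : 𝒜} {f : X ⟶ I} {g : I ⟶ C} {w : f ≫ g = 0}
    (h : (ShortComplex.mk f g w).ShortExact) (Q : 𝒜) :
    ∃ w' : biprod.map f (𝟙 Q) ≫ biprod.fst ≫ g = 0,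
      (ShortComplex.mk (biprod.map f (𝟙 Q)) (biprod.fst ≫ g) w').ShortExact := by
  have : Mono f := h.mono_f
  have : Epi g := h.epi_g
  have w' : biprod.map f (𝟙 Q) ≫ biprod.fst ≫ g = 0 := by simp [w]
  refine ⟨w', .mk' (ShortComplex.exact_of_g_is_cokernel _ ?_)
    (inferInstanceAs (Mono (biprod.map f (𝟙 Q)))) (epi_comp biprod.fst g)⟩
  refine CokernelCofork.IsColimit.ofπ' _ w' fun {Z} k hk ↦ ?_
  have hl : f ≫ biprod.inl ≫ k = 0 := by simpa using biprod.inl ≫= hk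
  have hr : biprod.inr ≫ k = 0 := by simpa using biprod.inr ≫= hk
  refine ⟨h.exact.desc (biprod.inl ≫ k) hl, biprod.hom_ext' _ _ ?_ ?_⟩
  · simpa using h.exact.g_desc (biprod.inl ≫ k) hl
  · simp [hr]

/-- **Schanuel's lemma** for injective objects. -/
lemma nonempty_schanuel_iso {X I C X' J D : 𝒜} [Injective I] [Injective J]
    {f : X ⟶ I} {g : I ⟶ C} {w : f ≫ g = 0} (h : (ShortComplex.mk f g w).ShortExact)
    {f' : X' ⟶ J} {g' : J ⟶ D} {w' : f' ≫ g' = 0} (h' : (ShortComplex.mk f' g' w').ShortExact)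
    (e : X ≅ X') : Nonempty (I ⊞ D ≅ J ⊞ C) := by
  have sq := IsPushout.of_hasPushout f (e.hom ≫ f')
  have h'' : (ShortComplex.mk (e.hom ≫ f') g' (by simp [w'])).ShortExact :=
    ShortComplex.shortExact_of_iso
      (ShortComplex.isoMk e.symm (Iso.refl _) (Iso.refl _) (by simp) (by simp) :
        ShortComplex.mk f' g' w' ≅ ShortComplex.mk (e.hom ≫ f') g' (by simp [w'])) h'
  obtain ⟨_, _, hC⟩ := h.of_isPushout sq
  obtain ⟨_, _, hD⟩ := h''.of_isPushout sq.flip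
  exact ⟨(splittingOfInjective hD).isoBinaryBiproduct.symm ≪≫
    (splittingOfInjective hC).isoBinaryBiproduct⟩

end ShortComplex.ShortExact

/-- Splitting off the last summand of a biproduct indexed by `Fin (m + 1)`. -/
noncomputable def biproductFinSuccIso (m : ℕ) (F : Fin (m + 1) → 𝒜) :
    ⨁ F ≅ F (Fin.last m) ⊞ ⨁ fun k : Fin m ↦ F k.castSucc where
  hom := biprod.lift (biproduct.π F _) (biproduct.lift fun k ↦ biproduct.π F k.castSucc)
  inv := biprod.desc (biproduct.ι F _) (biproduct.desc fun k ↦ biproduct.ι F k.castSucc)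
  hom_inv_id := by
    rw [biprod.lift_desc, biproduct.lift_desc]
    exact (add_comm _ _).trans <|
      (Fin.sum_univ_castSucc fun k ↦ biproduct.π F k ≫ biproduct.ι F k).symm.trans biproduct.total
  inv_hom_id := by
    ext
    · simp
    · simp [biproduct.ι_π_ne F (Fin.castSucc_ne_last _).symm]
    · simp [biproduct.ι_π_ne F (Fin.castSucc_ne_last _)]
    · simp [biproduct.ι_π, Fin.ext_iff]

/-- The alternating biproduct of the `A k` and `B k` for `k < m`, in descending order
`A (m - 1) ⊞ B (m - 2) ⊞ A (m - 3) ⊞ ⋯`. -/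
noncomputable abbrev alternatingBiproduct (A B : ℕ → 𝒜) (m : ℕ) : 𝒜 :=
  ⨁ fun k : Fin m ↦ if Even ((k : ℕ) + m) then B k else A k

/-- Splitting off the top summand exchanges the two alternating families. -/
noncomputable def alternatingBiproductSuccIso (A B : ℕ → 𝒜) (m : ℕ) :
    alternatingBiproduct A B (m + 1) ≅ A m ⊞ alternatingBiproduct B A m :=
  biproductFinSuccIso m _ ≪≫ biprod.mapIso
    (eqToIso (by simp [← add_assoc, Nat.even_add_one]))
    (biproduct.mapIso fun k ↦ eqToIso (by
      by_cases hk : Even ((k : ℕ) + m) <;> simp [← add_assoc, Nat.even_add_one, hk]))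

instance injective_alternatingBiproduct (A B : ℕ → 𝒜) [∀ k, Injective (A k)]
    [∀ k, Injective (B k)] (m : ℕ) : Injective (alternatingBiproduct A B m) := by
  have (k : Fin m) : Injective (if Even ((k : ℕ) + m) then B k else A k) := by
    split <;> infer_instance
  infer_instance

/-- Schanuel's lemma for two injective resolutions of the same object. -/
lemma nonempty_schanuel_resolution_iso (I G J H : ℕ → 𝒜)
    [∀ k, Injective (I k)] [∀ k, Injective (J k)] (e : G 0 ≅ H 0)
    (hG : ∀ k, ∃ (f : G k ⟶ I k) (g : I k ⟶ G (k + 1)) (w : f ≫ g = 0),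
      (ShortComplex.mk f g w).ShortExact)
    (hH : ∀ k, ∃ (f : H k ⟶ J k) (g : J k ⟶ H (k + 1)) (w : f ≫ g = 0),
      (ShortComplex.mk f g w).ShortExact) (m : ℕ) :
    Nonempty (alternatingBiproduct I J m ⊞ H m ≅ alternatingBiproduct J I m ⊞ G m) := by
  induction m with
  | zero =>
    exact ⟨biprod.mapIso (biproduct.whiskerEquiv (Equiv.refl _) fun k ↦ k.elim0) e.symm⟩
  | succ m ih =>
    obtain ⟨i⟩ := ih
    obtain ⟨f, g, w, h⟩ := hG m
    obtain ⟨f', g', w', h'⟩ := hH m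
    obtain ⟨_, hQ⟩ := h.biprod_map_id (alternatingBiproduct J I m)
    obtain ⟨_, hQ'⟩ := h'.biprod_map_id (alternatingBiproduct I J m)
    obtain ⟨j⟩ := hQ.nonempty_schanuel_iso hQ'
      (biprod.braiding _ _ ≪≫ i.symm ≪≫ biprod.braiding _ _)
    exact ⟨biprod.mapIso (alternatingBiproductSuccIso I J m) (Iso.refl _) ≪≫ j ≪≫
      biprod.mapIso (alternatingBiproductSuccIso J I m).symm (Iso.refl _)⟩

end CategoryTheory

/-- Proposition 3.4, second isomorphism (Schanuel's lemma for injective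
resolutions, odd case): given two injective resolutions of `E`, encoded by
cosyzygies `G`, `H` and short exact sequences `0 → G k → I k → G (k+1) → 0`
and `0 → H k → J k → H (k+1) → 0` with all `I k`, `J k` injective and
`G 0 ≅ E ≅ H 0`, then for every `n ≥ 1`,
`I⁰ ⊞ J¹ ⊞ ⋯ ⊞ J^{2n-1} ⊞ I^{2n} ⊞ H^{2n+1} ≅ J⁰ ⊞ I¹ ⊞ ⋯ ⊞ I^{2n-1} ⊞ J^{2n} ⊞ G^{2n+1}`. -/
theorem injective_schanuel_resolution_odd {𝒜 : Type u} [Category.{v} 𝒜] [Abelian 𝒜]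
    (E : 𝒜) (I G J H : ℕ → 𝒜)
    (hI : ∀ k, Injective (I k)) (hJ : ∀ k, Injective (J k))
    (eG : G 0 ≅ E) (eH : H 0 ≅ E)
    (hG : ∀ k, ∃ (f : G k ⟶ I k) (g : I k ⟶ G (k + 1)) (w : f ≫ g = 0),
      (ShortComplex.mk f g w).ShortExact)
    (hH : ∀ k, ∃ (f : H k ⟶ J k) (g : J k ⟶ H (k + 1)) (w : f ≫ g = 0),
      (ShortComplex.mk f g w).ShortExact)
    (n : ℕ) (hn : 1 ≤ n) :
    Nonempty
      ((⨁ fun k : Fin (2 * n + 1) => if Even (k : ℕ) then I (k : ℕ) else J (k : ℕ)) ⊞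
          H (2 * n + 1) ≅
       (⨁ fun k : Fin (2 * n + 1) => if Even (k : ℕ) then J (k : ℕ) else I (k : ℕ)) ⊞
          G (2 * n + 1)) := by
  obtain ⟨i⟩ := nonempty_schanuel_resolution_iso I G J H (eG ≪≫ eH.symm) hG hH (2 * n + 1)
  have hk (k : ℕ) : Even (k + (2 * n + 1)) ↔ ¬ Even k := by
    rw [← add_assoc, Nat.even_add_one, Nat.even_add]
    simp
  simpa only [alternatingBiproduct, hk, ite_not] using Nonempty.intro i
end

section
/- (Injective Dimension Theorem.) Let 𝒜 be an abelian category with enough injectives, let E be an object of 𝒜, and let n ≥ 1. The following are equivalent: (i) for every chain of objects F^0, …, F^n and I^0, …, I^{n-1} with F^0 ≅ E, each I^m (0 ≤ m ≤ n-1) injective, and short exact sequences 0 → F^m → I^m → F^{m+1} → 0 for 0 ≤ m ≤ n-1 (i.e., for every exact sequence 0 → E → I^0 → ⋯ → I^{n-1} → F → 0 with the I^m injective, where F = F^n), the object F^n is injective; (ii) there exist objects K^0, …, K^n and injective objects I^0, …, I^n with K^0 ≅ E, short exact sequences 0 → K^m → I^m → K^{m+1} → 0 for 0 ≤ m ≤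 n-1, and K^n ≅ I^n (i.e., there exists an exact sequence 0 → E → I^0 → ⋯ → I^{n-1} → I^n → 0 with all I^m injective). -/
open CategoryTheory CategoryTheory.Limits

universe v u

/-- In a chain of short exact sequences with injective middle terms, the last object is injective
iff the first object has injective dimension at most the length of the chain. -/
lemma injective_last_iff_hasInjectiveDimensionLT {𝒜 : Type u} [Category.{v} 𝒜] [Abelian 𝒜]
    {n : ℕ} (F : Fin (n + 1) → 𝒜) (I : Fin n → 𝒜) (hI : ∀ m, Injective (I m))
    (hF : ∀ m : Fin n, ∃ (f : F m.castSucc ⟶ I m) (g : I m ⟶ F m.succ) (w : f ≫ g = 0),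
      (ShortComplex.mk f g w).ShortExact) :
    Injective (F (Fin.last n)) ↔ HasInjectiveDimensionLT (F 0) (n + 1) := by
  induction n with
  | zero => exact injective_iff_hasInjectiveDimensionLT_one
  | succ n ih =>
    obtain ⟨f, g, w, hS⟩ := hF 0
    exact (ih (fun m ↦ F m.succ) (fun m ↦ I m.succ) (fun m ↦ hI m.succ)
      (fun m ↦ hF m.succ)).trans (hS.hasInjectiveDimensionLT_X₃_iff n (hI 0))

/-- The iterated cosyzygies of an object with respect to the chosen injective embeddings. -/
noncomputable def cosyzygy {𝒜 : Type u} [Category.{v} 𝒜] [Abelian 𝒜] [EnoughInjectives 𝒜]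
    (E : 𝒜) : ℕ → 𝒜
  | 0 => E
  | m + 1 => cokernel (Injective.ι (cosyzygy E m))

lemma exists_shortExact_cosyzygy {𝒜 : Type u} [Category.{v} 𝒜] [Abelian 𝒜] [EnoughInjectives 𝒜]
    (E : 𝒜) (m : ℕ) :
    ∃ (f : cosyzygy E m ⟶ Injective.under (cosyzygy E m))
      (g : Injective.under (cosyzygy E m) ⟶ cosyzygy E (m + 1)) (w : f ≫ g = 0),
      (ShortComplex.mk f g w).ShortExact :=
  ⟨Injective.ι _, cokernel.π _, cokernel.condition _,
    { exact := ShortComplex.exact_cokernel _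
      mono_f := inferInstanceAs (Mono (Injective.ι _))
      epi_g := inferInstanceAs (Epi (cokernel.π _)) }⟩

/-- Theorem 3.5 (Injective Dimension Theorem): for `n ≥ 1` and an object `E` of an
abelian category with enough injectives, the following are equivalent:
(i) for every exact sequence `0 → E → I⁰ → ⋯ → I^{n-1} → F → 0` (encoded as a chain
of short exact sequences `0 → F^m → I^m → F^{m+1} → 0` with `F⁰ ≅ E`) with all `I^m`
injective, the end object `F = Fⁿ` is injective;
(ii) there is an exact sequence `0 → E → I⁰ → ⋯ → I^{n-1} → Iⁿ → 0` with all `I^m`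
injective (encoded as a chain of short exact sequences `0 → K^m → I^m → K^{m+1} → 0`
with `K⁰ ≅ E` and `Kⁿ ≅ Iⁿ`). -/
theorem injective_dimension_theorem {𝒜 : Type u} [Category.{v} 𝒜] [Abelian 𝒜]
    [EnoughInjectives 𝒜] (E : 𝒜) (n : ℕ) (hn : 1 ≤ n) :
    (∀ (F : Fin (n + 1) → 𝒜) (I : Fin n → 𝒜),
        Nonempty (F 0 ≅ E) →
        (∀ m, Injective (I m)) →
        (∀ m : Fin n, ∃ (f : F m.castSucc ⟶ I m) (g : I m ⟶ F m.succ) (w : f ≫ g = 0),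
          (ShortComplex.mk f g w).ShortExact) →
        Injective (F (Fin.last n))) ↔
    (∃ (K : Fin (n + 1) → 𝒜) (I : Fin (n + 1) → 𝒜),
        Nonempty (K 0 ≅ E) ∧
        (∀ m, Injective (I m)) ∧
        (∀ m : Fin n, ∃ (f : K m.castSucc ⟶ I m.castSucc) (g : I m.castSucc ⟶ K m.succ)
          (w : f ≫ g = 0), (ShortComplex.mk f g w).ShortExact) ∧
        Nonempty (K (Fin.last n) ≅ I (Fin.last n))) := by
  constructor
  · intro h
    have hlast : Injective (cosyzygy E n) :=
      h (fun m ↦ cosyzygy E m) (fun m ↦ Injective.under (cosyzygy E m)) ⟨Iso.refl E⟩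
        (fun _ ↦ inferInstance) (fun m ↦ exists_shortExact_cosyzygy E m)
    refine ⟨fun m ↦ cosyzygy E m,
      Fin.snoc (α := fun _ ↦ 𝒜) (fun m : Fin n ↦ Injective.under (cosyzygy E m)) (cosyzygy E n),
      ⟨Iso.refl E⟩, fun m ↦ ?_, fun m ↦ ?_, ?_⟩
    · induction m using Fin.lastCases with
      | last => simpa only [Fin.snoc_last] using hlast
      | cast m =>
        rw [Fin.snoc_castSucc]
        infer_instance
    · rw [Fin.snoc_castSucc]
      exact exists_shortExact_cosyzygy E m
    · rw [Fin.snoc_last]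
      exact ⟨Iso.refl _⟩
  · rintro ⟨K, J, ⟨eK⟩, hJ, hK, ⟨e⟩⟩ F I ⟨eF⟩ hI hF
    have := Injective.of_iso e.symm (hJ _)
    have := (injective_last_iff_hasInjectiveDimensionLT K (fun m ↦ J m.castSucc)
      (fun m ↦ hJ m.castSucc) hK).1 this
    exact (injective_last_iff_hasInjectiveDimensionLT F I hI hF).2
      (hasInjectiveDimensionLT_of_iso (eK ≪≫ eF.symm) (n + 1))
end
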